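/- Chain of inequalities among multipartite correlation measures: for any n-partite state, E_sq^q(A₁:⋯:Aₙ) ≤ I(A₁:⋯:Aₙ) ≤ Δ_P(A₁:⋯:Aₙ), with equality throughout when the state is pure. -/

import Mathlib

open scoped BigOperators ComplexOrder

noncomputable section

/-- Von Neumann entropy of a matrix: `−∑ λᵢ log λᵢ` over its eigenvalues
(defined to be `0` if the matrix is not Hermitian). -/
noncomputable def matEntropy {ι : Type} [Fintype ι] [DecidableEq ι]
    (ρ : Matrix ι ι ℂ) : ℝ :=
  if h : ρ.IsHermitian then ∑ i, Real.negMulLog (h.eigenvalues i) else 0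

/-- A density matrix: positive semidefinite with unit trace. -/
def IsDensityMatrix {ι : Type} [Fintype ι] (ρ : Matrix ι ι ℂ) : Prop :=
  ρ.PosSemidef ∧ ρ.trace = 1

instance sumElimFintype {κ π : Type} {α : κ → Type} {δ : π → Type}
    [∀ i, Fintype (α i)] [∀ k, Fintype (δ k)] :
    ∀ i : κ ⊕ π, Fintype (Sum.elim α δ i)
  | .inl a => inferInstanceAs (Fintype (α a))
  | .inr b => inferInstanceAs (Fintype (δ b))

instance sumElimDecEq {κ π : Type} {α : κ → Type} {δ : π → Type}
    [∀ i, DecidableEq (α i)] [∀ k, DecidableEq (δ k)] :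
    ∀ i : κ ⊕ π, DecidableEq (Sum.elim α δ i)
  | .inl a => inferInstanceAs (DecidableEq (α a))
  | .inr b => inferInstanceAs (DecidableEq (δ b))

/-- Reduced density matrix on the subsystems in `s` (partial trace over the rest). -/
noncomputable def reduce {κ : Type} [Fintype κ] [DecidableEq κ] {α : κ → Type}
    [∀ i, Fintype (α i)] (s : Finset κ)
    (ρ : Matrix (∀ i, α i) (∀ i, α i) ℂ) :
    Matrix (∀ i : {j // j ∈ s}, α i.1) (∀ i : {j // j ∈ s}, α i.1) ℂ :=
  Matrix.of fun f g => ∑ h : ∀ i : {j // j ∉ s}, α i.1,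
    ρ (fun i => if hi : i ∈ s then f ⟨i, hi⟩ else h ⟨i, hi⟩)
      (fun i => if hi : i ∈ s then g ⟨i, hi⟩ else h ⟨i, hi⟩)

/-- The (pure) density matrix `|ψ⟩⟨ψ|` of a state vector. -/
def vecState {ι : Type} (ψ : ι → ℂ) : Matrix ι ι ℂ :=
  Matrix.of fun x y => ψ x * star (ψ y)

/-- Multipartite mutual information `∑ᵢ S_{Aᵢ} − S_{A₁⋯Aₙ}`. -/
noncomputable def Imulti {κ : Type} [Fintype κ] [DecidableEq κ] {α : κ → Type}
    [∀ i, Fintype (α i)] [∀ i, DecidableEq (α i)]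
    (ρ : Matrix (∀ i, α i) (∀ i, α i) ℂ) : ℝ :=
  (∑ i, matEntropy (reduce {i} ρ)) - matEntropy ρ

/-- Merge an assignment on the original systems with one on the ancillas. -/
def mergeSum {κ π : Type} {α : κ → Type} {δ : π → Type}
    (f : ∀ i, α i) (h : ∀ k, δ k) : ∀ i : κ ⊕ π, Sum.elim α δ i
  | .inl a => f a
  | .inr b => h b

/-- The subsystems belonging to party `k` together with its ancilla. -/
def partyFinset {κ π : Type} [Fintype κ] [DecidableEq κ] [DecidableEq π]
    (p : κ → π) (k : π) : Finset (κ ⊕ π) :=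
  (Finset.univ.filter fun i => p i = k).image Sum.inl ∪ {Sum.inr k}

/-- `ψ` (on the original systems plus one ancilla `Fin (d k)` per party)
purifies `ρ`: tracing out all ancillas from `|ψ⟩⟨ψ|` gives back `ρ`. -/
def Purifies {κ π : Type} [Fintype κ] {α : κ → Type} [∀ i, Fintype (α i)]
    [Fintype π] [DecidableEq π] {d : π → ℕ}
    (ψ : (∀ i : κ ⊕ π, Sum.elim α (fun k => Fin (d k)) i) → ℂ)
    (ρ : Matrix (∀ i, α i) (∀ i, α i) ℂ) : Prop :=
  ∀ f g, (∑ h : ∀ k, Fin (d k), vecState ψ (mergeSum f h) (mergeSum g h)) = ρ f g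

/-- Multipartite entanglement of purification for the partition of the systems `κ`
into parties `π` given by `p`: the infimum over all purifications (with one ancilla
per party, of arbitrary finite dimension) of `∑ₖ S_{AₖAₖ'}`. -/
noncomputable def DeltaPart {κ π : Type} [Fintype κ] [DecidableEq κ]
    [Fintype π] [DecidableEq π] {α : κ → Type}
    [∀ i, Fintype (α i)] [∀ i, DecidableEq (α i)]
    (p : κ → π) (ρ : Matrix (∀ i, α i) (∀ i, α i) ℂ) : ℝ :=
  sInf { x | ∃ (d : π → ℕ) (ψ : (∀ i : κ ⊕ π, Sum.elim α (fun k => Fin (d k)) i) → ℂ),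
    Purifies ψ ρ ∧
    x = ∑ k : π, matEntropy (reduce (partyFinset p k) (vecState ψ)) }

/-- Bipartite-style entanglement of purification for the partition `p`:
the infimum over purifications of the entropy of the single party `k₀`
together with its ancilla. -/
noncomputable def EPart {κ π : Type} [Fintype κ] [DecidableEq κ]
    [Fintype π] [DecidableEq π] {α : κ → Type}
    [∀ i, Fintype (α i)] [∀ i, DecidableEq (α i)]
    (p : κ → π) (k₀ : π) (ρ : Matrix (∀ i, α i) (∀ i, α i) ℂ) : ℝ :=
  sInf { x | ∃ (d : π → ℕ) (ψ : (∀ i : κ ⊕ π, Sum.elim α (fun k => Fin (d k)) i) → ℂ),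
    Purifies ψ ρ ∧
    x = matEntropy (reduce (partyFinset p k₀) (vecState ψ)) }

/-- The multipartite squashed entanglement `E_sq^q`: the infimum over all
extensions `ρ_{A₁⋯AₙE}` of `ρ` (with a finite-dimensional ancilla `E = Fin m`)
of the conditional multipartite mutual information
`I(A₁:⋯:Aₙ|E) = I(A₁:A₂|E) + I(A₁A₂:A₃|E) + ⋯ + I(A₁⋯A_{n−1}:Aₙ|E)`, where
`I(X:Y|E) = S_{XE} + S_{YE} − S_{XYE} − S_E`. -/
noncomputable def EsqMulti {n : ℕ} {α : Fin n → Type}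
    [∀ i, Fintype (α i)] [∀ i, DecidableEq (α i)]
    (ρ : Matrix (∀ i, α i) (∀ i, α i) ℂ) : ℝ :=
  sInf { x | ∃ (m : ℕ)
      (ρE : Matrix (∀ i : Fin n ⊕ Unit, Sum.elim α (fun _ => Fin m) i)
        (∀ i : Fin n ⊕ Unit, Sum.elim α (fun _ => Fin m) i) ℂ),
    ρE.PosSemidef ∧
    (∀ f g, (∑ h : ∀ _ : Unit, Fin m, ρE (mergeSum f h) (mergeSum g h)) = ρ f g) ∧
    x = ∑ k ∈ Finset.univ.filter (fun k : Fin n => (k : ℕ) ≠ 0),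
      (matEntropy (reduce ((Finset.Iio k).image Sum.inl ∪ {Sum.inr ()}) ρE)
        + matEntropy (reduce (({k} : Finset (Fin n)).image Sum.inl ∪ {Sum.inr ()}) ρE)
        - matEntropy (reduce ((Finset.Iic k).image Sum.inl ∪ {Sum.inr ()}) ρE)
        - matEntropy (reduce ({Sum.inr ()} : Finset (Fin n ⊕ Unit)) ρE)) }

/-- If all resolvent forms of one family of weights dominate those of another, then so do the
relative entropies, by integrating over the resolvent parameter. -/
lemma relEntropy_mono_of_resolvent {I J : Type} [Fintype I] [Fintype J]
    (w r s : I → ℝ) (w' r' s' : J → ℝ)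
    (hr : ∀ i, 0 ≤ r i) (hs : ∀ i, 0 ≤ s i) (hws : ∀ i, s i = 0 → w i * r i = 0)
    (hr' : ∀ i, 0 ≤ r' i) (hs' : ∀ i, 0 ≤ s' i) (hws' : ∀ i, s' i = 0 → w' i * r' i = 0)
    (hsum : ∑ i, w i * r i = ∑ i, w' i * r' i)
    (hF : ∀ t > 0, ∑ i, w' i * r' i * (r' i / (s' i + t * r' i)) ≤
      ∑ i, w i * r i * (r i / (s i + t * r i))) :
    ∑ i, w' i * r' i * (Real.log (r' i) - Real.log (s' i)) ≤
      ∑ i, w i * r i * (Real.log (r i) - Real.log (s i)) := by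
  have key : ∀ {K : Type} [Fintype K] (w r s : K → ℝ) (hr : ∀ i, 0 ≤ r i) (hs : ∀ i, 0 ≤ s i)
      (hws : ∀ i, s i = 0 → w i * r i = 0), ∀ t ≥ 0,
      HasDerivAt (fun t => ∑ i, w i * r i * (Real.log (s i + t * r i) - Real.log (s i)))
        (∑ i, w i * r i * (r i / (s i + t * r i))) t := by
    intro K _ w r s hr hs hws t ht
    refine HasDerivAt.fun_sum fun i _ => ?_
    rcases (hs i).eq_or_lt with h | h
    · simp only [hws i h.symm, zero_mul]
      exact hasDerivAt_const _ _
    · have hpos : 0 < s i + t * r i := by have := mul_nonneg ht (hr i); linarith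
      refine HasDerivAt.const_mul _ (HasDerivAt.sub_const _ ?_)
      refine HasDerivAt.log ?_ hpos.ne'
      simpa using ((hasDerivAt_id t).mul_const (r i)).const_add (s i)
  have hmono : ∀ T > 0, ∑ i, w' i * r' i * (Real.log (s' i + T * r' i) - Real.log (s' i)) ≤
      ∑ i, w i * r i * (Real.log (s i + T * r i) - Real.log (s i)) := by
    intro T hT
    have hd := fun t (ht : t ≥ 0) => (key w r s hr hs hws t ht).sub (key w' r' s' hr' hs' hws' t ht)
    have := monotoneOn_of_deriv_nonneg (convex_Ici (0 : ℝ))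
      (fun t ht => (hd t ht).continuousAt.continuousWithinAt)
      (fun t ht => (hd t (interior_subset ht)).differentiableAt.differentiableWithinAt)
      (fun t ht => by
        have h0 := interior_subset ht
        rw [interior_Ici] at ht
        rw [(hd t h0).deriv]
        exact sub_nonneg.2 (hF t ht))
      (Set.mem_Ici.2 le_rfl) (Set.mem_Ici.2 hT.le) hT.le
    simpa using this
  have hscale : ∀ {K : Type} [Fintype K] (w r s : K → ℝ) (hr : ∀ i, 0 ≤ r i) (hs : ∀ i, 0 ≤ s i)
      (hws : ∀ i, s i = 0 → w i * r i = 0), ∀ e > 0,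
      ∑ i, w i * r i * (Real.log (s i + e⁻¹ * r i) - Real.log (s i)) + Real.log e * ∑ i, w i * r i =
      ∑ i, w i * r i * (Real.log (e * s i + r i) - Real.log (s i)) := by
    intro K _ w r s hr hs hws e he
    rw [Finset.mul_sum, ← Finset.sum_add_distrib]
    refine Finset.sum_congr rfl fun i _ => ?_
    rcases (hs i).eq_or_lt with h | h
    · simp [hws i h.symm]
    · have hpos : 0 < s i + e⁻¹ * r i := by
        have := mul_nonneg (inv_pos.2 he).le (hr i); linarith
      have : e * s i + r i = e * (s i + e⁻¹ * r i) := by field_simp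
      rw [this, Real.log_mul he.ne' hpos.ne']
      ring
  have hlim : ∀ {K : Type} [Fintype K] (w r s : K → ℝ),
      Filter.Tendsto (fun e : ℝ => ∑ i, w i * r i * (Real.log (e * s i + r i) - Real.log (s i)))
        (nhdsWithin 0 (Set.Ioi 0))
        (nhds (∑ i, w i * r i * (Real.log (r i) - Real.log (s i)))) := by
    intro K _ w r s
    refine tendsto_finsetSum _ fun i _ => ?_
    by_cases h : r i = 0
    · simp [h]
    · refine Filter.Tendsto.const_mul _ (Filter.Tendsto.sub_const ?_ _)
      have : ContinuousAt (fun e : ℝ => Real.log (e * s i + r i)) 0 :=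
        ContinuousAt.log (by fun_prop) (by simpa using h)
      simpa using this.tendsto.mono_left nhdsWithin_le_nhds
  refine le_of_tendsto_of_tendsto (hlim w' r' s') (hlim w r s) ?_
  filter_upwards [self_mem_nhdsWithin] with e he
  rw [← hscale w' r' s' hr' hs' hws' e he, ← hscale w r s hr hs hws e he, hsum]
  gcongr
  exact hmono _ (inv_pos.2 he)

section Spectral

variable {X Y : Type} [Fintype X] [DecidableEq X] [Fintype Y] [DecidableEq Y]

lemma matEntropy_eq_charpoly_roots {A : Matrix X X ℂ} (hA : A.IsHermitian) :
    matEntropy A = (A.charpoly.roots.map fun z => Real.negMulLog z.re).sum := by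
  rw [matEntropy, dif_pos hA, hA.roots_charpoly_eq_eigenvalues]
  simp

lemma matEntropy_of_diagonalization {A U : Matrix X X ℂ} {d : X → ℝ} (hU : star U * U = 1)
    (hA : A = U * Matrix.diagonal (fun i => (d i : ℂ)) * star U) :
    matEntropy A = ∑ i, Real.negMulLog (d i) := by
  have hH : A.IsHermitian := by
    rw [hA, Matrix.IsHermitian, ← Matrix.star_eq_conjTranspose]
    simp only [star_mul, star_star, mul_assoc]
    congr 2
    rw [Matrix.star_eq_conjTranspose, Matrix.diagonal_conjTranspose]
    congr 1
    ext i
    simp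
  rw [matEntropy_eq_charpoly_roots hH, hA, Matrix.charpoly_mul_comm, ← mul_assoc, hU, one_mul,
    Matrix.charpoly_diagonal, Polynomial.roots_prod _ _ (by
      simp [Finset.prod_ne_zero_iff, Polynomial.X_sub_C_ne_zero])]
  simp

lemma matEntropy_submatrix_equiv {A : Matrix X X ℂ} (hA : A.IsHermitian) (e : Y ≃ X) :
    matEntropy (A.submatrix e e) = matEntropy A := by
  rw [matEntropy_eq_charpoly_roots hA, matEntropy_eq_charpoly_roots (hA.submatrix e)]
  have := Matrix.charpoly_reindex e.symm A
  rw [Matrix.reindex_apply, Equiv.symm_symm] at this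
  rw [this]

lemma Matrix.PosSemidef.exists_diagonalization {A : Matrix X X ℂ} (hA : A.PosSemidef) :
    ∃ (U : Matrix X X ℂ) (d : X → ℝ), star U * U = 1 ∧ U * star U = 1 ∧ (∀ i, 0 ≤ d i) ∧
      A = U * Matrix.diagonal (fun i => (d i : ℂ)) * star U := by
  refine ⟨hA.1.eigenvectorUnitary, hA.1.eigenvalues, ?_, ?_, hA.eigenvalues_nonneg, ?_⟩
  · simp
  · simp
  · have := hA.1.spectral_theorem
    rw [Unitary.conjStarAlgAut_apply] at this
    exact this

end Spectral

lemma support_of_cross {Z A : Type} [Fintype Z] [Fintype A] {U V : Matrix Z Z ℂ} {r s : Z → ℝ} {τ : A → ℝ}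
    (hr : ∀ i, 0 ≤ r i)
    (hc : ∀ g : ℝ → ℝ, ∑ p : Z × Z, Complex.normSq ((star U * V) p.1 p.2) * r p.2 * g (s p.1) =
      ∑ a, τ a * g (τ a)) (p : Z × Z) (hp : s p.1 = 0) :
    Complex.normSq ((star U * V) p.1 p.2) * r p.2 = 0 := by
  have h := hc (fun x => if x = 0 then 1 else 0)
  have h0 : ∑ a, τ a * (if τ a = 0 then 1 else 0 : ℝ) = 0 :=
    Finset.sum_eq_zero fun a _ => by split_ifs with h <;> simp [h]
  rw [h0, Finset.sum_eq_zero_iff_of_nonneg fun q _ =>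
    mul_nonneg (mul_nonneg (Complex.normSq_nonneg _) (hr _)) (by split_ifs <;> simp)] at h
  simpa [hp] using h p (Finset.mem_univ _)

section Resolvent

variable {Z : Type} [Fintype Z] [DecidableEq Z]

/-- The concave quadratic functional whose maximum over `X` is the resolvent form of the
pair `(ρ, σ)` at parameter `t`. -/
def resolventFunctional (t : ℝ) (ρ σ X : Matrix Z Z ℂ) : ℝ :=
  2 * (ρ * X).trace.re - (σ * (X * star X)).trace.re - t * (ρ * (star X * X)).trace.re

lemma resolventFunctional_conj {U V : Matrix Z Z ℂ} (hU : star U * U = 1) (hV : star V * V = 1)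
    (t : ℝ) (r s : Z → ℝ) (Y : Matrix Z Z ℂ) :
    resolventFunctional t (V * Matrix.diagonal (fun i => (r i : ℂ)) * star V)
      (U * Matrix.diagonal (fun i => (s i : ℂ)) * star U) (U * Y * star V) =
    ∑ p : Z × Z, (2 * r p.2 * (star ((star U * V) p.1 p.2) * Y p.1 p.2).re -
      (s p.1 + t * r p.2) * Complex.normSq (Y p.1 p.2)) := by
  have h1 : (V * Matrix.diagonal (fun i => (r i : ℂ)) * star V * (U * Y * star V)).trace =
      ∑ p : Z × Z, (r p.2 : ℂ) * (star ((star U * V) p.1 p.2) * Y p.1 p.2) := by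
    have : V * Matrix.diagonal (fun i => (r i : ℂ)) * star V * (U * Y * star V) =
      V * (Matrix.diagonal (fun i => (r i : ℂ)) * (star (star U * V) * Y) * star V) := by
      simp only [star_mul, star_star, mul_assoc]
    rw [this, Matrix.trace_mul_comm, mul_assoc, hV, mul_one, Matrix.trace, Fintype.sum_prod_type_right]
    refine Finset.sum_congr rfl fun j _ => ?_
    rw [Matrix.diag_apply, Matrix.diagonal_mul, Matrix.mul_apply, Finset.mul_sum]
    rfl
  have h2 : (U * Matrix.diagonal (fun i => (s i : ℂ)) * star U *
      (U * Y * star V * star (U * Y * star V))).trace =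
      ∑ p : Z × Z, ((s p.1 * Complex.normSq (Y p.1 p.2) : ℝ) : ℂ) := by
    have : U * Matrix.diagonal (fun i => (s i : ℂ)) * star U *
        (U * Y * star V * star (U * Y * star V)) =
      U * (Matrix.diagonal (fun i => (s i : ℂ)) * ((star U * U) * Y * (star V * V) * star Y)
        * star U) := by
      simp only [star_mul, star_star, mul_assoc]
    rw [this, Matrix.trace_mul_comm, mul_assoc, hU, hV, mul_one, one_mul, mul_one, Matrix.trace,
      Fintype.sum_prod_type]
    refine Finset.sum_congr rfl fun i _ => ?_
    rw [Matrix.diag_apply, Matrix.diagonal_mul, Matrix.mul_apply, Finset.mul_sum]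
    refine Finset.sum_congr rfl fun j _ => ?_
    push_cast
    rw [Complex.normSq_eq_conj_mul_self, mul_comm (starRingEnd ℂ _)]
    rfl
  have h3 : (V * Matrix.diagonal (fun i => (r i : ℂ)) * star V *
      (star (U * Y * star V) * (U * Y * star V))).trace =
      ∑ p : Z × Z, ((r p.2 * Complex.normSq (Y p.1 p.2) : ℝ) : ℂ) := by
    have : V * Matrix.diagonal (fun i => (r i : ℂ)) * star V *
        (star (U * Y * star V) * (U * Y * star V)) =
      V * (Matrix.diagonal (fun i => (r i : ℂ)) * ((star V * V) * star Y * (star U * U) * Y)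
        * star V) := by
      simp only [star_mul, star_star, mul_assoc]
    rw [this, Matrix.trace_mul_comm, mul_assoc, hU, hV, mul_one, one_mul, mul_one, Matrix.trace,
      Fintype.sum_prod_type_right]
    refine Finset.sum_congr rfl fun j _ => ?_
    rw [Matrix.diag_apply, Matrix.diagonal_mul, Matrix.mul_apply, Finset.mul_sum]
    refine Finset.sum_congr rfl fun i _ => ?_
    push_cast
    rw [Complex.normSq_eq_conj_mul_self]
    rfl
  rw [resolventFunctional, h1, h2, h3]
  simp only [Complex.re_sum, Complex.ofReal_re, Finset.mul_sum, Complex.re_ofReal_mul,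
    ← Finset.sum_sub_distrib]
  refine Finset.sum_congr rfl fun p _ => ?_
  ring

lemma two_mul_re_sub_le {a b : ℝ} (ha : 0 ≤ a) (hab : a = 0 → b = 0) (w y : ℂ) :
    2 * b * (star w * y).re - a * Complex.normSq y ≤ Complex.normSq w * b * (b / a) := by
  rcases ha.eq_or_lt with h | h
  · simp [hab h.symm, ← h]
  · have : Complex.normSq w * b * (b / a) - (2 * b * (star w * y).re - a * Complex.normSq y) =
        ((a * y.re - b * w.re) ^ 2 + (a * y.im - b * w.im) ^ 2) / a := by
      simp only [Complex.normSq_apply, Complex.mul_re, Complex.star_def, Complex.conj_re,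
        Complex.conj_im]
      field_simp
      ring
    have h2 : 0 ≤ ((a * y.re - b * w.re) ^ 2 + (a * y.im - b * w.im) ^ 2) / a := by positivity
    linarith

lemma two_mul_re_sub_eq {a b : ℝ} (hab : a = 0 → b = 0) (w : ℂ) :
    2 * b * (star w * (((b / a : ℝ) : ℂ) * w)).re - a * Complex.normSq (((b / a : ℝ) : ℂ) * w) =
      Complex.normSq w * b * (b / a) := by
  by_cases h : a = 0
  · simp [hab h, h]
  · simp only [Complex.normSq_apply, Complex.mul_re, Complex.mul_im, Complex.star_def,
      Complex.conj_re, Complex.conj_im, Complex.ofReal_re, Complex.ofReal_im]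
    field_simp
    ring

lemma add_mul_eq_zero_right {s t r : ℝ} (hs : 0 ≤ s) (ht : 0 < t) (hr : 0 ≤ r)
    (h : s + t * r = 0) : r = 0 := by
  have := mul_nonneg ht.le hr
  have h0 : t * r = 0 := by linarith
  exact (mul_eq_zero.1 h0).resolve_left ht.ne'

lemma resolventFunctional_le {U V : Matrix Z Z ℂ} (hU : star U * U = 1) (hV : star V * V = 1)
    (hU' : U * star U = 1) (hV' : V * star V = 1)
    {t : ℝ} (ht : 0 < t) {r s : Z → ℝ} (hr : ∀ i, 0 ≤ r i) (hs : ∀ i, 0 ≤ s i)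
    (X : Matrix Z Z ℂ) :
    resolventFunctional t (V * Matrix.diagonal (fun i => (r i : ℂ)) * star V)
      (U * Matrix.diagonal (fun i => (s i : ℂ)) * star U) X ≤
    ∑ p : Z × Z, Complex.normSq ((star U * V) p.1 p.2) * r p.2 *
      (r p.2 / (s p.1 + t * r p.2)) := by
  have hX : X = U * (star U * X * V) * star V := by
    calc X = (U * star U) * X * (V * star V) := by rw [hU', hV', one_mul, mul_one]
      _ = _ := by simp only [mul_assoc]
  rw [hX, resolventFunctional_conj hU hV]
  refine Finset.sum_le_sum fun p _ => two_mul_re_sub_le ?_ ?_ _ _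
  · have := hs p.1; have := mul_nonneg ht.le (hr p.2); linarith
  · exact add_mul_eq_zero_right (hs _) ht (hr _)

lemma exists_resolventFunctional_eq {U V : Matrix Z Z ℂ} (hU : star U * U = 1)
    (hV : star V * V = 1) {t : ℝ} (ht : 0 < t) {r s : Z → ℝ} (hr : ∀ i, 0 ≤ r i)
    (hs : ∀ i, 0 ≤ s i) :
    ∃ X, resolventFunctional t (V * Matrix.diagonal (fun i => (r i : ℂ)) * star V)
      (U * Matrix.diagonal (fun i => (s i : ℂ)) * star U) X =
    ∑ p : Z × Z, Complex.normSq ((star U * V) p.1 p.2) * r p.2 *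
      (r p.2 / (s p.1 + t * r p.2)) := by
  refine ⟨U * (Matrix.of fun i j => ((r j / (s i + t * r j) : ℝ) : ℂ) * (star U * V) i j) * star V,
    ?_⟩
  rw [resolventFunctional_conj hU hV]
  exact Finset.sum_congr rfl fun p _ =>
    two_mul_re_sub_eq (add_mul_eq_zero_right (hs _) ht (hr _)) _

lemma sum_normSq_unitary_mul {U V : Matrix Z Z ℂ} (hU' : U * star U = 1) (hV : star V * V = 1)
    (f : Z → ℝ) :
    ∑ p : Z × Z, Complex.normSq ((star U * V) p.1 p.2) * f p.2 = ∑ j, f j := by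
  rw [Fintype.sum_prod_type_right]
  refine Finset.sum_congr rfl fun j _ => ?_
  change ∑ i, Complex.normSq ((star U * V) i j) * f j = f j
  rw [← Finset.sum_mul]
  have h1 : star (star U * V) * (star U * V) = 1 := by
    rw [star_mul, star_star, mul_assoc, ← mul_assoc U, hU', one_mul, hV]
  have h2 := congrFun (congrFun h1 j) j
  rw [Matrix.mul_apply, Matrix.one_apply_eq] at h2
  have h3 : ((∑ i, Complex.normSq ((star U * V) i j) : ℝ) : ℂ) = 1 := by
    rw [← h2]
    push_cast
    exact Finset.sum_congr rfl fun i _ => Complex.normSq_eq_conj_mul_self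
  rw [show ∑ i, Complex.normSq ((star U * V) i j) = 1 by exact_mod_cast h3, one_mul]

lemma sum_relEntropy_eq {A : Type} [Fintype A] {U V : Matrix Z Z ℂ} (hU' : U * star U = 1)
    (hV : star V * V = 1) {r s : Z → ℝ} {τ : A → ℝ}
    (hc : ∀ g : ℝ → ℝ, ∑ p : Z × Z, Complex.normSq ((star U * V) p.1 p.2) * r p.2 * g (s p.1) =
      ∑ a, τ a * g (τ a)) :
    ∑ p : Z × Z, Complex.normSq ((star U * V) p.1 p.2) * r p.2 *
      (Real.log (r p.2) - Real.log (s p.1)) =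
    ∑ a, Real.negMulLog (τ a) - ∑ j, Real.negMulLog (r j) := by
  have h1 := sum_normSq_unitary_mul hU' hV (fun j => r j * Real.log (r j))
  have h2 := hc Real.log
  simp only [Real.negMulLog, neg_mul, Finset.sum_neg_distrib]
  rw [← h1, ← h2]
  simp only [mul_sub, Finset.sum_sub_distrib, mul_assoc]
  ring

end Resolvent

/-- Monotonicity of relative entropy under restriction to a subalgebra, when the entropy
of the reference state relative to the first state is itself an entropy. -/
theorem entropy_difference_mono {Z Z' A A' : Type} [Fintype Z] [DecidableEq Z] [Fintype Z']
    [DecidableEq Z'] [Fintype A] [Fintype A']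
    {U V : Matrix Z Z ℂ} {U' V' : Matrix Z' Z' ℂ} {r s : Z → ℝ} {r' s' : Z' → ℝ}
    {τ : A → ℝ} {τ' : A' → ℝ}
    (hU : star U * U = 1) (hU₂ : U * star U = 1) (hV : star V * V = 1) (hV₂ : V * star V = 1)
    (hU' : star U' * U' = 1) (hU₂' : U' * star U' = 1) (hV' : star V' * V' = 1)
    (hr : ∀ i, 0 ≤ r i) (hs : ∀ i, 0 ≤ s i) (hr' : ∀ i, 0 ≤ r' i) (hs' : ∀ i, 0 ≤ s' i)
    (hc : ∀ g : ℝ → ℝ, ∑ p : Z × Z, Complex.normSq ((star U * V) p.1 p.2) * r p.2 * g (s p.1) =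
      ∑ a, τ a * g (τ a))
    (hc' : ∀ g : ℝ → ℝ, ∑ p : Z' × Z', Complex.normSq ((star U' * V') p.1 p.2) * r' p.2 *
      g (s' p.1) = ∑ a, τ' a * g (τ' a))
    (hsum : ∑ i, r i = ∑ i, r' i)
    (ι : Matrix Z' Z' ℂ →⋆ₙₐ[ℂ] Matrix Z Z ℂ)
    (hρ : ∀ X, ((V * Matrix.diagonal (fun i => (r i : ℂ)) * star V) * ι X).trace =
      ((V' * Matrix.diagonal (fun i => (r' i : ℂ)) * star V') * X).trace)
    (hσ : ∀ X, ((U * Matrix.diagonal (fun i => (s i : ℂ)) * star U) * ι X).trace =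
      ((U' * Matrix.diagonal (fun i => (s' i : ℂ)) * star U') * X).trace) :
    ∑ a, Real.negMulLog (τ' a) - ∑ j, Real.negMulLog (r' j) ≤
      ∑ a, Real.negMulLog (τ a) - ∑ j, Real.negMulLog (r j) := by
  rw [← sum_relEntropy_eq hU₂ hV hc, ← sum_relEntropy_eq hU₂' hV' hc']
  refine relEntropy_mono_of_resolvent _ _ _ _ _ _ (fun _ => hr _) (fun _ => hs _)
    (support_of_cross hr hc) (fun _ => hr' _) (fun _ => hs' _)
    (support_of_cross hr' hc') ?_ ?_
  · rw [sum_normSq_unitary_mul hU₂ hV, sum_normSq_unitary_mul hU₂' hV', hsum]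
  · intro t ht
    obtain ⟨X, hX⟩ := exists_resolventFunctional_eq hU' hV' ht hr' hs'
    rw [← hX]
    refine le_trans (le_of_eq ?_) (resolventFunctional_le hU hV hU₂ hV₂ ht hr hs (ι X))
    simp only [resolventFunctional, ← map_star, ← map_mul, hρ, hσ]

section PartialTrace

set_option linter.unusedSectionVars false

variable {Z X Y : Type} [Fintype Z] [DecidableEq Z] [Fintype X] [DecidableEq X]
  [DecidableEq Y]

/-- Partial trace of `ρ`, where `p` reads off the subsystem that is kept and `q` the one that is
traced out. -/
def partialTrace {Z X Y : Type} [Fintype Z] [DecidableEq X] [DecidableEq Y]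
    (p : Z → X) (q : Z → Y) (ρ : Matrix Z Z ℂ) : Matrix X X ℂ :=
  Matrix.of fun x x' => ∑ z, ∑ z', if p z = x ∧ p z' = x' ∧ q z = q z' then ρ z z' else 0

/-- The operator acting as `M` on the subsystem read off by `p` and trivially on that read off
by `q`. -/
def ampliation {Z X Y : Type} [DecidableEq Y] (p : Z → X) (q : Z → Y) (M : Matrix X X ℂ) :
    Matrix Z Z ℂ :=
  Matrix.of fun z z' => if q z = q z' then M (p z) (p z') else 0

lemma trace_mul_ampliation (p : Z → X) (q : Z → Y) (ρ : Matrix Z Z ℂ) (M : Matrix X X ℂ) :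
    (ρ * ampliation p q M).trace = (partialTrace p q ρ * M).trace := by
  simp only [Matrix.trace, Matrix.diag_apply, Matrix.mul_apply, ampliation, partialTrace,
    Matrix.of_apply, Finset.sum_mul]
  calc ∑ z, ∑ z', ρ z z' * (if q z' = q z then M (p z') (p z) else 0)
      = ∑ z, ∑ z', ∑ x, ∑ x',
        (if p z = x ∧ p z' = x' ∧ q z = q z' then ρ z z' else 0) * M x' x := by
        refine Finset.sum_congr rfl fun z _ => Finset.sum_congr rfl fun z' _ => ?_
        by_cases h : q z = q z'
        · simp [h, ite_and]
        · simp [h, Ne.symm h]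
    _ = _ := by
        rw [Finset.sum_congr rfl fun z _ => Finset.sum_comm, Finset.sum_comm]
        refine Finset.sum_congr rfl fun x _ => ?_
        rw [Finset.sum_congr rfl fun z _ => Finset.sum_comm, Finset.sum_comm]

lemma ampliation_diagonal {p : Z → X} {q : Z → Y}
    (h : Function.Injective fun z => (p z, q z)) (d : X → ℂ) :
    ampliation p q (Matrix.diagonal d) = Matrix.diagonal fun z => d (p z) := by
  ext z z'
  simp only [ampliation, Matrix.of_apply, Matrix.diagonal_apply]
  by_cases hz : z = z'
  · simp [hz]
  · rw [if_neg hz]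
    split_ifs with h1 h2
    · exact absurd (h (Prod.ext h2 h1)) hz
    · rfl
    · rfl

lemma ampliation_one {p : Z → X} {q : Z → Y} (h : Function.Injective fun z => (p z, q z)) :
    ampliation p q (1 : Matrix X X ℂ) = 1 := by
  rw [← Matrix.diagonal_one, ampliation_diagonal h, Matrix.diagonal_one]

lemma ampliation_mul {p : Z → X} {q : Z → Y} [Fintype Y]
    (h : Function.Bijective fun z => (p z, q z)) (M N : Matrix X X ℂ) :
    ampliation p q (M * N) = ampliation p q M * ampliation p q N := by
  ext z z'
  simp only [ampliation, Matrix.of_apply, Matrix.mul_apply]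
  rw [show (∑ j, (if q z = q j then M (p z) (p j) else 0) *
      if q j = q z' then N (p j) (p z') else 0) = _ from
    (Equiv.ofBijective _ h).sum_comp (fun a : X × Y => (if q z = a.2 then M (p z) a.1 else 0) *
    (if a.2 = q z' then N a.1 (p z') else 0)), Fintype.sum_prod_type]
  split_ifs with hq
  · simp [hq]
  · simp [hq]

lemma ampliation_star (p : Z → X) (q : Z → Y) (M : Matrix X X ℂ) :
    ampliation p q (star M) = star (ampliation p q M) := by
  ext z z'
  simp only [ampliation, Matrix.of_apply, Matrix.star_apply, eq_comm]
  split_ifs <;> simp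

/-- Ampliation as a homomorphism of star algebras. -/
def ampliationHom {p : Z → X} {q : Z → Y} [Fintype Y]
    (h : Function.Bijective fun z => (p z, q z)) : Matrix X X ℂ →⋆ₙₐ[ℂ] Matrix Z Z ℂ where
  toFun := ampliation p q
  map_smul' c M := by ext; simp [ampliation]
  map_zero' := by ext; simp [ampliation]
  map_add' M N := by ext z z'; simp only [ampliation, Matrix.of_apply, Matrix.add_apply]; split_ifs <;> simp
  map_mul' := ampliation_mul h
  map_star' := ampliation_star p q

lemma Matrix.PosSemidef.partialTrace [Fintype Y] {ρ : Matrix Z Z ℂ} (hρ : ρ.PosSemidef) (p : Z → X)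
    (q : Z → Y) : (partialTrace p q ρ).PosSemidef := by
  have : _root_.partialTrace p q ρ = ∑ y : Y,
      (Matrix.of fun x z => if p z = x ∧ q z = y then (1 : ℂ) else 0) * ρ *
        (Matrix.of fun x z => if p z = x ∧ q z = y then (1 : ℂ) else 0).conjTranspose := by
    ext x x'
    simp only [_root_.partialTrace, Matrix.of_apply, Matrix.sum_apply, Matrix.mul_apply,
      Matrix.conjTranspose_apply, Finset.sum_mul]
    rw [Finset.sum_comm, Finset.sum_comm (s := (Finset.univ : Finset Y))]
    refine Finset.sum_congr rfl fun z' _ => ?_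
    rw [Finset.sum_comm (s := (Finset.univ : Finset Y))]
    refine Finset.sum_congr rfl fun z _ => ?_
    by_cases h1 : p z = x <;> by_cases h2 : p z' = x' <;> by_cases h3 : q z = q z' <;>
      simp [h1, h2, h3, eq_comm (a := q z')]
  rw [this]
  exact Matrix.posSemidef_sum _ fun y _ => hρ.mul_mul_conjTranspose_same _

lemma trace_partialTrace {p : Z → X} {q : Z → Y} (h : Function.Injective fun z => (p z, q z))
    (ρ : Matrix Z Z ℂ) : (partialTrace p q ρ).trace = ρ.trace := by
  have := trace_mul_ampliation p q ρ 1
  rwa [ampliation_one h, mul_one, mul_one, eq_comm] at this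

lemma partialTrace_partialTrace {X' Y' : Type} [DecidableEq X'] [DecidableEq Y']
    (P : Z → X) (Q : Z → Y) (p : X → X') (q : X → Y') (R : Matrix Z Z ℂ) :
    partialTrace p q (partialTrace P Q R) =
      partialTrace (fun z => p (P z)) (fun z => (q (P z), Q z)) R := by
  ext a b
  simp only [partialTrace, Matrix.of_apply, Prod.mk.injEq]
  calc ∑ x, ∑ x', (if p x = a ∧ p x' = b ∧ q x = q x' then
        ∑ z, ∑ z', (if P z = x ∧ P z' = x' ∧ Q z = Q z' then R z z' else 0) else 0)
      = ∑ x, ∑ x', ∑ z, ∑ z', (if p x = a ∧ p x' = b ∧ q x = q x' then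
         (if P z = x ∧ P z' = x' ∧ Q z = Q z' then R z z' else 0) else 0) := by
        refine Finset.sum_congr rfl fun x _ => Finset.sum_congr rfl fun x' _ => ?_
        split_ifs <;> simp
    _ = ∑ z, ∑ z', ∑ x, ∑ x', (if p x = a ∧ p x' = b ∧ q x = q x' then
         (if P z = x ∧ P z' = x' ∧ Q z = Q z' then R z z' else 0) else 0) := by
        rw [Finset.sum_congr rfl fun x _ => Finset.sum_comm, Finset.sum_comm]
        refine Finset.sum_congr rfl fun z _ => ?_
        rw [Finset.sum_congr rfl fun x _ => Finset.sum_comm, Finset.sum_comm]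
    _ = _ := by
        refine Finset.sum_congr rfl fun z _ => Finset.sum_congr rfl fun z' _ => ?_
        rw [Finset.sum_eq_single (P z), Finset.sum_eq_single (P z')]
        · by_cases h : Q z = Q z' <;> simp [h]
        · intro x' _ hx'
          simp [Ne.symm hx']
        · simp
        · intro x _ hx
          simp [Ne.symm hx]
        · simp

lemma partialTrace_congr_right {Y' : Type} [DecidableEq Y'] (p : Z → X) {q : Z → Y} {q' : Z → Y'}
    (hq : ∀ z z', q z = q z' ↔ q' z = q' z') (ρ : Matrix Z Z ℂ) :
    partialTrace p q ρ = partialTrace p q' ρ := by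
  ext x x'
  simp only [partialTrace, Matrix.of_apply, hq]

lemma cross_of_partialTrace [Fintype Y] {p : Z → X} {q : Z → Y}
    (h : Function.Bijective fun z => (p z, q z))
    {V : Matrix Z Z ℂ} {r : Z → ℝ} {U₀ : Matrix X X ℂ} {τ : X → ℝ} (hU₀ : star U₀ * U₀ = 1)
    (hτ : partialTrace p q (V * Matrix.diagonal (fun i => (r i : ℂ)) * star V) =
      U₀ * Matrix.diagonal (fun i => (τ i : ℂ)) * star U₀) (g : ℝ → ℝ) :
    ∑ i : Z × Z, Complex.normSq ((star (ampliation p q U₀) * V) i.1 i.2) * r i.2 * g (τ (p i.1)) =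
      ∑ a, τ a * g (τ a) := by
  set U := ampliation p q U₀ with hU
  have hD : U * Matrix.diagonal (fun z => (g (τ (p z)) : ℂ)) * star U =
      ampliation p q (U₀ * Matrix.diagonal (fun a => (g (τ a) : ℂ)) * star U₀) := by
    rw [ampliation_mul h, ampliation_mul h, ampliation_diagonal h.1, ampliation_star]
  have h1 : (V * Matrix.diagonal (fun i => (r i : ℂ)) * star V *
      (U * Matrix.diagonal (fun z => (g (τ (p z)) : ℂ)) * star U)).trace =
      ((∑ i : Z × Z, Complex.normSq ((star U * V) i.1 i.2) * r i.2 * g (τ (p i.1)) : ℝ) : ℂ) := by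
    have : V * Matrix.diagonal (fun i => (r i : ℂ)) * star V *
        (U * Matrix.diagonal (fun z => (g (τ (p z)) : ℂ)) * star U) =
      V * (Matrix.diagonal (fun i => (r i : ℂ)) * (star (star U * V) *
        Matrix.diagonal (fun z => (g (τ (p z)) : ℂ))) * star U) := by
      simp only [star_mul, star_star, mul_assoc]
    rw [this, Matrix.trace_mul_comm, mul_assoc, mul_assoc, mul_assoc, Matrix.trace,
      Fintype.sum_prod_type_right]
    push_cast
    refine Finset.sum_congr rfl fun j _ => ?_
    rw [Matrix.diag_apply, Matrix.diagonal_mul, Matrix.mul_apply, Finset.mul_sum]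
    refine Finset.sum_congr rfl fun i _ => ?_
    rw [Matrix.diagonal_mul, Complex.normSq_eq_conj_mul_self, Matrix.star_apply, Complex.star_def]
    ring
  have h2 : (V * Matrix.diagonal (fun i => (r i : ℂ)) * star V *
      (U * Matrix.diagonal (fun z => (g (τ (p z)) : ℂ)) * star U)).trace =
      ((∑ a, τ a * g (τ a) : ℝ) : ℂ) := by
    rw [hD, trace_mul_ampliation, hτ]
    have : U₀ * Matrix.diagonal (fun i => (τ i : ℂ)) * star U₀ *
        (U₀ * Matrix.diagonal (fun a => (g (τ a) : ℂ)) * star U₀) =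
      U₀ * (Matrix.diagonal (fun i => (τ i : ℂ)) * (star U₀ * U₀) *
        Matrix.diagonal (fun a => (g (τ a) : ℂ)) * star U₀) := by
      simp only [mul_assoc]
    rw [this, Matrix.trace_mul_comm, mul_assoc, hU₀, mul_one, mul_one, Matrix.diagonal_mul_diagonal,
      Matrix.trace_diagonal]
    push_cast
    rfl
  exact_mod_cast h1.symm.trans h2

end PartialTrace

section StrongSubadditivity

variable {X Y W : Type} [Fintype X] [DecidableEq X] [Fintype Y] [DecidableEq Y]
  [Fintype W] [DecidableEq W]

lemma partialTrace_ampliation (N : Matrix (Y × W) (Y × W) ℂ) :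
    partialTrace (fun z : X × Y × W => (z.1, z.2.1)) (fun z => z.2.2)
      (ampliation (fun z => z.2) (fun z => z.1) N) =
    ampliation (fun z : X × Y => z.2) (fun z => z.1)
      (partialTrace (fun z => z.1) (fun z => z.2) N) := by
  ext ⟨x, y⟩ ⟨x', y'⟩
  simp only [partialTrace, ampliation, Matrix.of_apply, Fintype.sum_prod_type, Prod.mk.injEq]
  by_cases h : x = x'
  · simp [h, ite_and]
    refine Finset.sum_congr rfl fun w _ => ?_
    rw [Finset.sum_eq_single y']
    · simp
    · intro b _ hb
      simp [hb]
    · simp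
  · rw [if_neg h]
    refine Finset.sum_eq_zero fun a _ => Finset.sum_eq_zero fun b _ => Finset.sum_eq_zero fun c _ =>
      Finset.sum_eq_zero fun a' _ => Finset.sum_eq_zero fun b' _ => Finset.sum_eq_zero fun c' _ => ?_
    split_ifs with h1 h2
    · exact absurd (by rw [← h1.1.1, ← h1.2.1.1, h2]) h
    · rfl
    · rfl

/-- Strong subadditivity of the von Neumann entropy. -/
theorem matEntropy_strong_subadditivity {ρ : Matrix (X × Y × W) (X × Y × W) ℂ}
    (hρ : ρ.PosSemidef) :
    matEntropy ρ + matEntropy (partialTrace (fun z => z.2.1) (fun z => (z.1, z.2.2)) ρ) ≤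
      matEntropy (partialTrace (fun z => (z.1, z.2.1)) (fun z => z.2.2) ρ) +
      matEntropy (partialTrace (fun z => z.2) (fun z => z.1) ρ) := by
  have b1 : Function.Bijective fun z : X × Y × W => (z.2, z.1) := (Equiv.prodComm _ _).bijective
  have b2 : Function.Bijective fun z : X × Y => (z.2, z.1) := (Equiv.prodComm _ _).bijective
  have b3 : Function.Bijective fun z : X × Y × W => ((z.1, z.2.1), z.2.2) :=
    (Equiv.prodAssoc _ _ _).symm.bijective
  set ρXY := partialTrace (fun z : X × Y × W => (z.1, z.2.1)) (fun z => z.2.2) ρ with hXY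
  set ρYW := partialTrace (fun z : X × Y × W => z.2) (fun z => z.1) ρ with hYW
  set ρY := partialTrace (fun z : X × Y × W => z.2.1) (fun z => (z.1, z.2.2)) ρ with hY
  have hY1 : partialTrace (fun z : X × Y => z.2) (fun z => z.1) ρXY = ρY :=
    partialTrace_partialTrace _ _ _ _ _
  have hY2 : partialTrace (fun z : Y × W => z.1) (fun z => z.2) ρYW = ρY := by
    rw [hYW, partialTrace_partialTrace, hY]
    exact partialTrace_congr_right _ (by simp [and_comm]) _
  obtain ⟨V, r, hV, hV₂, hr, eρ⟩ := hρ.exists_diagonalization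
  obtain ⟨V', r', hV', hV₂', hr', eρXY⟩ :=
    (hρ.partialTrace (fun z : X × Y × W => (z.1, z.2.1)) (fun z => z.2.2)).exists_diagonalization
  obtain ⟨U₀, τ, hU, hU₂, hτ, eρYW⟩ :=
    (hρ.partialTrace (fun z : X × Y × W => z.2) (fun z => z.1)).exists_diagonalization
  obtain ⟨U₀', τ', hU', hU₂', hτ', eρY⟩ :=
    (hρ.partialTrace (fun z : X × Y × W => z.2.1) (fun z => (z.1, z.2.2))).exists_diagonalization
  rw [← hXY] at eρXY
  rw [← hYW] at eρYW
  rw [← hY] at eρY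
  rw [matEntropy_of_diagonalization hV eρ, matEntropy_of_diagonalization hV' eρXY,
    matEntropy_of_diagonalization hU eρYW, matEntropy_of_diagonalization hU' eρY]
  have hσ : ampliation (fun z : X × Y × W => z.2) (fun z => z.1) U₀ *
      Matrix.diagonal (fun i : X × Y × W => (τ i.2 : ℂ)) *
      star (ampliation (fun z : X × Y × W => z.2) (fun z => z.1) U₀) =
      ampliation (fun z : X × Y × W => z.2) (fun z => z.1) ρYW := by
    rw [eρYW, ampliation_mul b1, ampliation_mul b1, ampliation_star, ampliation_diagonal b1.1]
  have hσ' : ampliation (fun z : X × Y => z.2) (fun z => z.1) U₀' *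
      Matrix.diagonal (fun i : X × Y => (τ' i.2 : ℂ)) *
      star (ampliation (fun z : X × Y => z.2) (fun z => z.1) U₀') =
      ampliation (fun z : X × Y => z.2) (fun z => z.1) ρY := by
    rw [eρY, ampliation_mul b2, ampliation_mul b2, ampliation_star, ampliation_diagonal b2.1]
  have main := entropy_difference_mono
    (U := ampliation (fun z : X × Y × W => z.2) (fun z => z.1) U₀) (V := V)
    (U' := ampliation (fun z : X × Y => z.2) (fun z => z.1) U₀') (V' := V')
    (r := r) (s := fun z => τ z.2) (r' := r') (s' := fun z => τ' z.2) (τ := τ) (τ' := τ')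
    (by rw [← ampliation_star, ← ampliation_mul b1, hU, ampliation_one b1.1])
    (by rw [← ampliation_star, ← ampliation_mul b1, hU₂, ampliation_one b1.1]) hV hV₂
    (by rw [← ampliation_star, ← ampliation_mul b2, hU', ampliation_one b2.1])
    (by rw [← ampliation_star, ← ampliation_mul b2, hU₂', ampliation_one b2.1]) hV'
    hr (fun _ => hτ _) hr' (fun _ => hτ' _)
    (cross_of_partialTrace b1 hU (by rw [← eρ, ← hYW, eρYW]))
    (cross_of_partialTrace b2 hU' (by rw [← eρXY, hY1, eρY]))
    (by
      have h := trace_partialTrace b3.1 ρ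
      rw [← hXY, eρXY, eρ, Matrix.trace_mul_comm, ← mul_assoc, hV', one_mul,
        Matrix.trace_mul_comm, ← mul_assoc, hV, one_mul, Matrix.trace_diagonal,
        Matrix.trace_diagonal] at h
      exact_mod_cast h.symm)
    (ampliationHom b3)
    (fun M => by
      rw [← eρ, ← eρXY]
      exact trace_mul_ampliation _ _ _ _)
    (fun M => by
      rw [hσ, hσ', ← hY2, ← partialTrace_ampliation]
      exact trace_mul_ampliation _ _ _ _)
  linarith

end StrongSubadditivity

section Marginals

open scoped Kronecker

variable {X Y Z X' Y' Z' : Type} [Fintype X] [DecidableEq X] [Fintype Y] [DecidableEq Y]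
  [Fintype Z] [DecidableEq Z] [Fintype X'] [DecidableEq X'] [DecidableEq Y'] [Fintype Z']

set_option linter.unusedSectionVars false

lemma matEntropy_partialTrace_congr {p : Z → X} {p' : Z → X'} {q : Z → Y} {q' : Z → Y'}
    (hp : Function.Surjective p) (hp' : Function.Surjective p')
    (hpp : ∀ z z', p z = p z' ↔ p' z = p' z') (hqq : ∀ z z', q z = q z' ↔ q' z = q' z')
    {ρ : Matrix Z Z ℂ} (hρ : ρ.PosSemidef) :
    matEntropy (partialTrace p q ρ) = matEntropy (partialTrace p' q' ρ) := by
  have he : ∀ z, p' (Function.surjInv hp (p z)) = p' z := fun z =>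
    (hpp _ _).1 (Function.surjInv_eq hp (p z))
  let e : X ≃ X' := Equiv.ofBijective (fun x => p' (Function.surjInv hp x)) (by
    constructor
    · intro x y hxy
      have := (hpp _ _).2 hxy
      rwa [Function.surjInv_eq hp, Function.surjInv_eq hp] at this
    · intro x'
      obtain ⟨z, rfl⟩ := hp' x'
      exact ⟨p z, he z⟩)
  have hpe : ∀ z x, p z = x ↔ p' z = e x := fun z x => by
    obtain ⟨w, rfl⟩ := hp x
    rw [hpp, show e (p w) = p' w from he w]
  have : (partialTrace p' q' ρ).submatrix e e = partialTrace p q ρ := by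
    ext x x'
    simp only [partialTrace, Matrix.submatrix_apply, Matrix.of_apply, hpe, hqq]
  have hH : (partialTrace p' q' ρ).IsHermitian := by
    rw [← partialTrace_congr_right p' hqq]
    exact (hρ.partialTrace p' q).1
  rw [← matEntropy_submatrix_equiv hH e, this]

lemma partialTrace_comp_bijective {E : Z → Z'} (hE : Function.Bijective E) (p : Z' → X)
    (q : Z' → Y) {ρ : Matrix Z' Z' ℂ} {ρ' : Matrix Z Z ℂ}
    (h : ∀ z z', ρ' z z' = ρ (E z) (E z')) :
    partialTrace (fun z => p (E z)) (fun z => q (E z)) ρ' = partialTrace p q ρ := by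
  ext x x'
  simp only [partialTrace, Matrix.of_apply, h]
  rw [← (Equiv.ofBijective E hE).sum_comp]
  refine Finset.sum_congr rfl fun z _ => ?_
  rw [← (Equiv.ofBijective E hE).sum_comp]
  rfl

lemma partialTrace_kronecker_left (p : Z → X) (q : Z → Y) (ρ : Matrix Z Z ℂ)
    (σ : Matrix X' X' ℂ) :
    partialTrace (fun a : Z × X' => (p a.1, a.2)) (fun a => q a.1) (ρ ⊗ₖ σ) =
      partialTrace p q ρ ⊗ₖ σ := by
  ext ⟨x, a⟩ ⟨x', a'⟩
  simp only [partialTrace, Matrix.of_apply, Matrix.kronecker_apply, Fintype.sum_prod_type,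
    Prod.mk.injEq, Finset.sum_mul]
  refine Finset.sum_congr rfl fun z _ => ?_
  rw [Finset.sum_eq_single a]
  · refine Finset.sum_congr rfl fun z' _ => ?_
    rw [Finset.sum_eq_single a']
    · simp [ite_mul]
    · intro b _ hb
      simp [hb]
    · simp
  · intro b _ hb
    simp [hb]
  · simp

lemma sum_eq_one_of_trace {A U : Matrix X X ℂ} {d : X → ℝ} (hU : star U * U = 1)
    (hA : A = U * Matrix.diagonal (fun i => (d i : ℂ)) * star U) (htr : A.trace = 1) :
    ∑ i, d i = 1 := by
  rw [hA, Matrix.trace_mul_comm, ← mul_assoc, hU, one_mul, Matrix.trace_diagonal] at htr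
  exact_mod_cast htr

lemma matEntropy_kronecker {ρ : Matrix X X ℂ} {σ : Matrix Y Y ℂ} (hρ : IsDensityMatrix ρ)
    (hσ : IsDensityMatrix σ) :
    matEntropy (ρ ⊗ₖ σ) = matEntropy ρ + matEntropy σ := by
  obtain ⟨U, d, hU, -, -, eU⟩ := hρ.1.exists_diagonalization
  obtain ⟨V, d', hV, -, -, eV⟩ := hσ.1.exists_diagonalization
  have h : (ρ ⊗ₖ σ) = (U ⊗ₖ V) *
      Matrix.diagonal (fun i : X × Y => ((d i.1 * d' i.2 : ℝ) : ℂ)) *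
      star (U ⊗ₖ V) := by
    have hd : Matrix.diagonal (fun i : X × Y => ((d i.1 * d' i.2 : ℝ) : ℂ)) =
        Matrix.diagonal (fun i => (d i : ℂ)) ⊗ₖ Matrix.diagonal (fun i => (d' i : ℂ)) := by
      rw [Matrix.diagonal_kronecker_diagonal]
      push_cast
      rfl
    rw [hd, Matrix.star_eq_conjTranspose,
      Matrix.conjTranspose_kronecker, ← Matrix.mul_kronecker_mul,
      ← Matrix.mul_kronecker_mul, ← Matrix.star_eq_conjTranspose, ← Matrix.star_eq_conjTranspose,
      ← eU, ← eV]
  have hW : star (U ⊗ₖ V) * (U ⊗ₖ V) = 1 := by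
    rw [Matrix.star_eq_conjTranspose, Matrix.conjTranspose_kronecker,
      ← Matrix.mul_kronecker_mul, ← Matrix.star_eq_conjTranspose, ← Matrix.star_eq_conjTranspose,
      hU, hV, Matrix.one_kronecker_one]
  rw [matEntropy_of_diagonalization hW h, matEntropy_of_diagonalization hU eU,
    matEntropy_of_diagonalization hV eV, Fintype.sum_prod_type]
  simp only [Real.negMulLog_mul, Finset.sum_add_distrib, ← Finset.sum_mul, ← Finset.mul_sum]
  rw [sum_eq_one_of_trace hU eU hρ.2, sum_eq_one_of_trace hV eV hσ.2]
  ring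

lemma matEntropy_of_idempotent {A : Matrix X X ℂ} (hA : A.PosSemidef) (h : A * A = A) :
    matEntropy A = 0 := by
  obtain ⟨U, d, hU, hU', -, eU⟩ := hA.exists_diagonalization
  rw [matEntropy_of_diagonalization hU eU]
  have hD : Matrix.diagonal (fun i => (d i : ℂ)) = star U * A * U := by
    rw [eU]
    calc _ = (star U * U) * Matrix.diagonal (fun i => (d i : ℂ)) * (star U * U) := by
            rw [hU, one_mul, mul_one]
      _ = _ := by simp only [mul_assoc]
  have hDD : Matrix.diagonal (fun i => (d i : ℂ)) * Matrix.diagonal (fun i => (d i : ℂ)) =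
      Matrix.diagonal (fun i => (d i : ℂ)) := by
    rw [hD]
    calc star U * A * U * (star U * A * U) = star U * A * (U * star U) * A * U := by
          simp only [mul_assoc]
      _ = star U * (A * A) * U := by rw [hU', mul_one, mul_assoc (star U)]
      _ = _ := by rw [h]
  refine Finset.sum_eq_zero fun i _ => ?_
  have := congrFun (congrFun hDD i) i
  rw [Matrix.diagonal_mul_diagonal, Matrix.diagonal_apply_eq, Matrix.diagonal_apply_eq] at this
  have h2 : d i * d i = d i := by exact_mod_cast this
  have h3 : d i * (d i - 1) = 0 := by linarith
  rcases mul_eq_zero.1 h3 with h | h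
  · simp [h]
  · simp [sub_eq_zero.1 h]

lemma matEntropy_eq_zero_of_unique [Unique X] {A : Matrix X X ℂ} (hA : IsDensityMatrix A) :
    matEntropy A = 0 := by
  refine matEntropy_of_idempotent hA.1 ?_
  have h : A = 1 := by
    ext i j
    have := hA.2
    rw [Matrix.trace, Fintype.sum_unique, Matrix.diag_apply] at this
    rw [Subsingleton.elim i default, Subsingleton.elim j default, this, Matrix.one_apply_eq]
  rw [h, mul_one]

lemma vecState_posSemidef (ψ : X → ℂ) : (vecState ψ).PosSemidef :=
  Matrix.posSemidef_vecMulVec_self_star ψ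

lemma vecState_mul_self {ψ : X → ℂ} (h : (vecState ψ).trace = 1) :
    vecState ψ * vecState ψ = vecState ψ := by
  ext x y
  have h' : ∑ z, ψ z * star (ψ z) = 1 := h
  simp only [vecState, Matrix.mul_apply, Matrix.of_apply]
  calc ∑ z, ψ x * star (ψ z) * (ψ z * star (ψ y))
      = ψ x * (∑ z, ψ z * star (ψ z)) * star (ψ y) := by
        rw [Finset.mul_sum, Finset.sum_mul]
        exact Finset.sum_congr rfl fun z _ => by ring
    _ = _ := by rw [h', mul_one]

lemma matEntropy_vecState {ψ : X → ℂ} (h : (vecState ψ).trace = 1) :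
    matEntropy (vecState ψ) = 0 :=
  matEntropy_of_idempotent (vecState_posSemidef ψ) (vecState_mul_self h)

end Marginals

section Subsystems

set_option linter.unusedSectionVars false

variable {κ : Type} [Fintype κ] [DecidableEq κ] {α : κ → Type} [∀ i, Fintype (α i)]
  [∀ i, DecidableEq (α i)]

lemma IsDensityMatrix.nonempty {ι : Type} [Fintype ι] {ρ : Matrix ι ι ℂ} (h : IsDensityMatrix ρ) :
    Nonempty ι := by
  by_contra hn
  rw [not_nonempty_iff] at hn
  have := h.2
  simp [Matrix.trace] at this

lemma reduce_eq_partialTrace (s : Finset κ) (ρ : Matrix (∀ i, α i) (∀ i, α i) ℂ) :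
    reduce s ρ = partialTrace (fun z (i : {j // j ∈ s}) => z i.1)
      (fun z (i : {j // j ∉ s}) => z i.1) ρ := by
  ext f g
  simp only [reduce, partialTrace, Matrix.of_apply]
  rw [← (Equiv.piEquivPiSubtypeProd (· ∈ s) α).symm.sum_comp, Fintype.sum_prod_type]
  have h1 : ∀ a : (∀ i : {j // j ∈ s}, α i.1) × (∀ i : {j // j ∉ s}, α i.1),
      (fun i : {j // j ∈ s} => (Equiv.piEquivPiSubtypeProd (· ∈ s) α).symm a i.1) = a.1 := by
    intro a
    ext i
    simp [Equiv.piEquivPiSubtypeProd, i.2]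
  have h2 : ∀ a : (∀ i : {j // j ∈ s}, α i.1) × (∀ i : {j // j ∉ s}, α i.1),
      (fun i : {j // j ∉ s} => (Equiv.piEquivPiSubtypeProd (· ∈ s) α).symm a i.1) = a.2 := by
    intro a
    ext i
    simp [Equiv.piEquivPiSubtypeProd, i.2]
  rw [Finset.sum_eq_single f]
  · refine Finset.sum_congr rfl fun h _ => ?_
    rw [← (Equiv.piEquivPiSubtypeProd (· ∈ s) α).symm.sum_comp, Fintype.sum_prod_type,
      Finset.sum_eq_single g, Finset.sum_eq_single h]
    · simp only [h1, h2, and_self, if_true]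
      rfl
    · intro b _ hb
      simp only [h1, h2, Ne.symm hb, and_false, if_false]
    · simp
    · intro b _ hb
      simp only [h1, hb, false_and, and_false, if_false, Finset.sum_const_zero]
    · simp
  · intro b _ hb
    simp only [h1, hb, false_and, if_false, Finset.sum_const_zero]
  · simp

variable {X Y : Type} [Fintype X] [DecidableEq X] [Fintype Y] [DecidableEq Y]

lemma restrict_surjective (h : Nonempty (∀ i, α i)) (s : Finset κ) :
    Function.Surjective fun (z : ∀ i, α i) (i : {j // j ∈ s}) => z i.1 := by
  intro f
  obtain ⟨z⟩ := h
  refine ⟨fun i => if hi : i ∈ s then f ⟨i, hi⟩ else z i, ?_⟩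
  ext i
  simp [i.2]

lemma matEntropy_reduce_eq {s : Finset κ} {p : (∀ i, α i) → X} {q : (∀ i, α i) → Y}
    (hps : Function.Surjective p) (hp : ∀ z z', p z = p z' ↔ ∀ i ∈ s, z i = z' i)
    (hq : ∀ z z', q z = q z' ↔ ∀ i ∉ s, z i = z' i)
    {ρ : Matrix (∀ i, α i) (∀ i, α i) ℂ} (hρ : IsDensityMatrix ρ) :
    matEntropy (reduce s ρ) = matEntropy (partialTrace p q ρ) := by
  rw [reduce_eq_partialTrace]
  refine matEntropy_partialTrace_congr (restrict_surjective hρ.nonempty s) hps ?_ ?_ hρ.1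
  · intro z z'
    rw [hp]
    simp [funext_iff]
  · intro z z'
    rw [hq]
    simp [funext_iff]

lemma IsDensityMatrix.partialTrace {Z : Type} [Fintype Z] [DecidableEq Z] {ρ : Matrix Z Z ℂ}
    (hρ : IsDensityMatrix ρ)
    {p : Z → X} {q : Z → Y} (h : Function.Injective fun z => (p z, q z)) :
    IsDensityMatrix (partialTrace p q ρ) :=
  ⟨hρ.1.partialTrace p q, by rw [trace_partialTrace h, hρ.2]⟩

lemma IsDensityMatrix.reduce {ρ : Matrix (∀ i, α i) (∀ i, α i) ℂ} (hρ : IsDensityMatrix ρ)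
    (s : Finset κ) : IsDensityMatrix (reduce s ρ) := by
  rw [reduce_eq_partialTrace]
  refine hρ.partialTrace fun z z' h => ?_
  ext i
  by_cases hi : i ∈ s
  · exact congrFun (congrArg Prod.fst h) ⟨i, hi⟩
  · exact congrFun (congrArg Prod.snd h) ⟨i, hi⟩

lemma matEntropy_reduce_univ {ρ : Matrix (∀ i, α i) (∀ i, α i) ℂ} (hρ : IsDensityMatrix ρ) :
    matEntropy (reduce Finset.univ ρ) = matEntropy ρ := by
  rw [matEntropy_reduce_eq (p := id) (q := fun _ => ()) Function.surjective_id
    (by simp [funext_iff]) (by simp) hρ]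
  congr 1
  ext z z'
  simp [partialTrace, ite_and]

lemma matEntropy_reduce_empty {ρ : Matrix (∀ i, α i) (∀ i, α i) ℂ} (hρ : IsDensityMatrix ρ) :
    matEntropy (reduce ∅ ρ) = 0 := by
  rw [matEntropy_reduce_eq (p := fun _ => ()) (q := id)
    (fun _ => ⟨hρ.nonempty.some, rfl⟩) (by simp) (by simp [funext_iff]) hρ]
  exact matEntropy_eq_zero_of_unique (hρ.partialTrace fun z z' h => (Prod.ext_iff.1 h).2)

/-- Strong subadditivity for disjoint sets of subsystems. -/
lemma matEntropy_reduce_strong_subadditivity {ρ : Matrix (∀ i, α i) (∀ i, α i) ℂ}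
    (hρ : IsDensityMatrix ρ) {s t u : Finset κ} (hst : Disjoint s t) (hsu : Disjoint s u)
    (htu : Disjoint t u) :
    matEntropy (reduce (s ∪ t ∪ u) ρ) + matEntropy (reduce t ρ) ≤
      matEntropy (reduce (s ∪ t) ρ) + matEntropy (reduce (t ∪ u) ρ) := by
  rw [Finset.disjoint_left] at hst hsu htu
  let P : (∀ i, α i) → (∀ i : {j // j ∈ s}, α i.1) × (∀ i : {j // j ∈ t}, α i.1) ×
    (∀ i : {j // j ∈ u}, α i.1) := fun z => (fun i => z i.1, fun i => z i.1, fun i => z i.1)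
  let Q : (∀ i, α i) → (∀ i : {j // j ∉ s ∪ t ∪ u}, α i.1) := fun z i => z i.1
  have hP : Function.Surjective P := by
    rintro ⟨a, b, c⟩
    obtain ⟨z⟩ := hρ.nonempty
    refine ⟨fun i => if hi : i ∈ s then a ⟨i, hi⟩ else if hi : i ∈ t then b ⟨i, hi⟩ else
      if hi : i ∈ u then c ⟨i, hi⟩ else z i, ?_⟩
    refine Prod.ext ?_ (Prod.ext ?_ ?_)
    · ext ⟨i, hi⟩
      simp [P, hi]
    · ext ⟨i, hi⟩
      have h1 : i ∉ s := fun h => hst h hi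
      simp [P, hi, h1]
    · ext ⟨i, hi⟩
      have h1 : i ∉ s := fun h => hsu h hi
      have h2 : i ∉ t := fun h => htu h hi
      simp [P, hi, h1, h2]
  have (v : Finset κ) : Nonempty (∀ i : {j // j ∈ v}, α i.1) := ⟨fun i => hρ.nonempty.some i.1⟩
  have main := matEntropy_strong_subadditivity (hρ.1.partialTrace P Q)
  rw [partialTrace_partialTrace, partialTrace_partialTrace, partialTrace_partialTrace] at main
  rw [matEntropy_reduce_eq (s := s ∪ t ∪ u) (p := P) (q := Q) hP _ _ hρ,
    matEntropy_reduce_eq (s := t) (p := fun z => (P z).2.1) (q := fun z =>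
      (((P z).1, (P z).2.2), Q z)) _ _ _ hρ,
    matEntropy_reduce_eq (s := s ∪ t) (p := fun z => ((P z).1, (P z).2.1)) (q := fun z =>
      ((P z).2.2, Q z)) _ _ _ hρ,
    matEntropy_reduce_eq (s := t ∪ u) (p := fun z => (P z).2) (q := fun z =>
      ((P z).1, Q z)) _ _ _ hρ]
  · exact main
  · exact Prod.snd_surjective.comp hP
  · intro z z'
    simp only [P, Prod.mk.injEq, funext_iff, Subtype.forall, Finset.mem_union]
    grind
  · intro z z'
    simp only [P, Q, Prod.mk.injEq, funext_iff, Subtype.forall, Finset.mem_union]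
    grind
  · have : Function.Surjective fun a : (∀ i : {j // j ∈ s}, α i.1) × (∀ i : {j // j ∈ t}, α i.1) ×
        (∀ i : {j // j ∈ u}, α i.1) => (a.1, a.2.1) := by
      rintro ⟨a, b⟩
      exact ⟨(a, b, fun i => hρ.nonempty.some i.1), rfl⟩
    exact this.comp hP
  · intro z z'
    simp only [P, Prod.mk.injEq, funext_iff, Subtype.forall, Finset.mem_union]
    grind
  · intro z z'
    simp only [P, Q, Prod.mk.injEq, funext_iff, Subtype.forall, Finset.mem_union]
    grind
  · exact Prod.fst_surjective.comp (Prod.snd_surjective.comp hP)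
  · intro z z'
    simp only [P, funext_iff, Subtype.forall]
  · intro z z'
    simp only [P, Q, Prod.mk.injEq, funext_iff, Subtype.forall, Finset.mem_union]
    grind
  · intro z z'
    simp only [P, Prod.mk.injEq, funext_iff, Subtype.forall, Finset.mem_union]
    grind
  · intro z z'
    simp only [Q, funext_iff, Subtype.forall]

end Subsystems

section MutualInformation

variable {κ : Type} [Fintype κ] [DecidableEq κ] {α : κ → Type} [∀ i, Fintype (α i)]
  [∀ i, DecidableEq (α i)]

lemma matEntropy_reduce_le_sum {ρ : Matrix (∀ i, α i) (∀ i, α i) ℂ} (hρ : IsDensityMatrix ρ)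
    (T : Finset κ) : matEntropy (reduce T ρ) ≤ ∑ k ∈ T, matEntropy (reduce {k} ρ) := by
  induction T using Finset.induction_on with
  | empty => simp [matEntropy_reduce_empty hρ]
  | insert k T hk ih =>
    have h := matEntropy_reduce_strong_subadditivity hρ (s := T) (t := ∅) (u := {k})
      (by simp) (by simpa using hk) (by simp)
    rw [Finset.union_empty, Finset.empty_union, matEntropy_reduce_empty hρ, Finset.union_comm,
      ← Finset.insert_eq] at h
    rw [Finset.sum_insert hk]
    linarith

lemma Imulti_nonneg {ρ : Matrix (∀ i, α i) (∀ i, α i) ℂ} (hρ : IsDensityMatrix ρ) :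
    0 ≤ Imulti ρ := by
  have h := matEntropy_reduce_le_sum hρ Finset.univ
  rw [matEntropy_reduce_univ hρ] at h
  exact sub_nonneg.2 h

end MutualInformation

lemma sum_filter_ne_zero_Iio_add_sub_Iic {n : ℕ} (g : Finset (Fin n) → ℝ) (hg : g ∅ = 0) :
    ∑ k ∈ Finset.univ.filter (fun k : Fin n => (k : ℕ) ≠ 0),
      (g (Finset.Iio k) + g {k} - g (Finset.Iic k)) = (∑ k, g {k}) - g Finset.univ := by
  let G : ℕ → ℝ := fun j => g (Finset.univ.filter fun k : Fin n => (k : ℕ) < j)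
  have hIio (k : Fin n) : g (Finset.Iio k) = G k := by
    congr 1
    ext i
    simp
  have hIic (k : Fin n) : g (Finset.Iic k) = G (k + 1) := by
    congr 1
    ext i
    simp only [Finset.mem_Iic, Finset.mem_filter, Finset.mem_univ, true_and, Nat.lt_succ_iff]
    exact Fin.le_def
  have h0 : G 0 = 0 := by simpa [G] using hg
  have hn : G n = g Finset.univ := by simp [G]
  rw [Finset.sum_filter_of_ne]
  · have : ∑ k : Fin n, (G (k + 1) - G k) = G n - G 0 := by
      rw [Fin.sum_univ_eq_sum_range fun j => G (j + 1) - G j, Finset.sum_range_sub]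
    rw [Finset.sum_sub_distrib] at this
    simp only [hIio, hIic, Finset.sum_sub_distrib, Finset.sum_add_distrib]
    linarith
  · rintro k - hk h
    apply hk
    have h1 : Finset.Iic k = {k} := by
      ext i
      simp only [Finset.mem_Iic, Finset.mem_singleton, Fin.le_def, Fin.ext_iff]
      omega
    rw [hIio, h1, h, h0]
    ring

section Ancilla

set_option linter.unusedSectionVars false

variable {κ π : Type} {α : κ → Type} {δ : π → Type}

/-- The assignment on the original systems. -/
def leftPart (z : ∀ i : κ ⊕ π, Sum.elim α δ i) : ∀ a, α a := fun a => z (.inl a)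

/-- The assignment on the ancillas. -/
def rightPart (z : ∀ i : κ ⊕ π, Sum.elim α δ i) : ∀ b, δ b := fun b => z (.inr b)

/-- Split an assignment into its original and ancilla parts. -/
def splitEquiv (α : κ → Type) (δ : π → Type) :
    (∀ i : κ ⊕ π, Sum.elim α δ i) ≃ (∀ a, α a) × (∀ b, δ b) where
  toFun z := (leftPart z, rightPart z)
  invFun a := mergeSum a.1 a.2
  left_inv z := by
    funext i
    cases i <;> rfl
  right_inv _ := rfl

lemma forall_imp_eq_iff (P : κ ⊕ π → Prop) (z z' : ∀ i : κ ⊕ π, Sum.elim α δ i) :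
    (∀ i, P i → z i = z' i) ↔ (∀ a, P (.inl a) → leftPart z a = leftPart z' a) ∧
      ∀ b, P (.inr b) → rightPart z b = rightPart z' b := Sum.forall

lemma leftPart_surjective [∀ b, Nonempty (δ b)] :
    Function.Surjective (leftPart : (∀ i : κ ⊕ π, Sum.elim α δ i) → _) :=
  fun f => ⟨mergeSum f fun b => Classical.arbitrary (δ b), rfl⟩

variable [Fintype κ] [DecidableEq κ] [Fintype π] [DecidableEq π] [∀ i, Fintype (α i)]
  [∀ i, DecidableEq (α i)] [∀ i, Fintype (δ i)] [∀ i, DecidableEq (δ i)]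

lemma partialTrace_leftPart_apply
    (M : Matrix (∀ i : κ ⊕ π, Sum.elim α δ i) (∀ i : κ ⊕ π, Sum.elim α δ i) ℂ) (f g : ∀ a, α a) :
    partialTrace leftPart rightPart M f g = ∑ h, M (mergeSum f h) (mergeSum g h) := by
  simp only [partialTrace, Matrix.of_apply]
  have key (F : (∀ i : κ ⊕ π, Sum.elim α δ i) → ℂ) :
      ∑ z, F z = ∑ f, ∑ h, F (mergeSum f h) := by
    rw [← (splitEquiv α δ).symm.sum_comp, Fintype.sum_prod_type]
    rfl
  have hl (f : ∀ a, α a) (h : ∀ b, δ b) : leftPart (mergeSum f h) = f := rfl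
  have hr (f : ∀ a, α a) (h : ∀ b, δ b) : rightPart (mergeSum f h) = h := rfl
  rw [key, Finset.sum_eq_single f]
  · refine Finset.sum_congr rfl fun h _ => ?_
    rw [key, Finset.sum_eq_single g, Finset.sum_eq_single h]
    · simp [hl, hr]
    · intro b _ hb
      simp [hr, Ne.symm hb]
    · simp
    · intro b _ hb
      simp [hl, hb]
    · simp
  · intro b _ hb
    simp [hl, hb]
  · simp

lemma split_injective : Function.Injective fun z : (∀ i : κ ⊕ π, Sum.elim α δ i) =>
    (leftPart z, rightPart z) := (splitEquiv α δ).injective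

lemma split_bijective : Function.Bijective fun z : (∀ i : κ ⊕ π, Sum.elim α δ i) =>
    (leftPart z, rightPart z) := (splitEquiv α δ).bijective

variable {M : Matrix (∀ i : κ ⊕ π, Sum.elim α δ i) (∀ i : κ ⊕ π, Sum.elim α δ i) ℂ}
  {ρ : Matrix (∀ i, α i) (∀ i, α i) ℂ}

lemma isDensityMatrix_of_partialTrace_leftPart (hM : M.PosSemidef)
    (h : partialTrace leftPart rightPart M = ρ) (hρ : IsDensityMatrix ρ) : IsDensityMatrix M :=
  ⟨hM, by rw [← trace_partialTrace split_injective, h, hρ.2]⟩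

lemma matEntropy_reduce_image_inl (hM : IsDensityMatrix M)
    (h : partialTrace leftPart rightPart M = ρ) (S : Finset κ) :
    matEntropy (reduce (S.image Sum.inl) M) = matEntropy (reduce S ρ) := by
  rw [reduce_eq_partialTrace S ρ, ← h, partialTrace_partialTrace]
  refine matEntropy_reduce_eq ?_ ?_ ?_ hM
  · have : Nonempty (∀ a, α a) := hM.nonempty.map leftPart
    have (b : π) : Nonempty (δ b) := hM.nonempty.map fun z => rightPart z b
    exact (restrict_surjective ‹_› S).comp leftPart_surjective
  · intro z z'
    rw [forall_imp_eq_iff]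
    simp [funext_iff]
  · intro z z'
    rw [forall_imp_eq_iff]
    simp [funext_iff]

lemma matEntropy_reduce_of_subsingleton [∀ b, Unique (δ b)] {s : Finset (κ ⊕ π)} {S : Finset κ}
    (hs : ∀ a, Sum.inl a ∈ s ↔ a ∈ S) (hM : IsDensityMatrix M)
    (h : ∀ z z', M z z' = ρ (leftPart z) (leftPart z')) :
    matEntropy (reduce s M) = matEntropy (reduce S ρ) := by
  have hr (z z' : ∀ i : κ ⊕ π, Sum.elim α δ i) : rightPart z = rightPart z' :=
    Subsingleton.elim _ _
  have hE : Function.Bijective (leftPart : (∀ i : κ ⊕ π, Sum.elim α δ i) → _) := by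
    refine ⟨fun z z' hz => ?_, leftPart_surjective⟩
    funext i
    cases i with
    | inl a => exact congrFun hz a
    | inr b => exact congrFun (hr z z') b
  rw [reduce_eq_partialTrace S ρ, ← partialTrace_comp_bijective hE _ _ h]
  refine matEntropy_reduce_eq ?_ ?_ ?_ hM
  · exact (restrict_surjective (hM.nonempty.map leftPart) S).comp hE.2
  · intro z z'
    rw [forall_imp_eq_iff]
    simp [funext_iff, hs, hr z z']
  · intro z z'
    rw [forall_imp_eq_iff]
    simp [funext_iff, hs, hr z z']

end Ancilla

section Factorization

open scoped MatrixOrder Matrix.Norms.L2Operator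

lemma Matrix.PosSemidef.exists_eq_conjTranspose_mul_self {X : Type} [Fintype X] [DecidableEq X]
    {A : Matrix X X ℂ} (hA : A.PosSemidef) : ∃ B : Matrix X X ℂ, A = B.conjTranspose * B :=
  CStarAlgebra.nonneg_iff_eq_star_mul_self.mp hA.nonneg

end Factorization

section Extensions

open scoped Kronecker

variable {κ : Type} [Fintype κ] [DecidableEq κ] {α : κ → Type} [∀ i, Fintype (α i)]
  [∀ i, DecidableEq (α i)] {m : ℕ}
  {M : Matrix (∀ i : κ ⊕ Unit, Sum.elim α (fun _ => Fin m) i)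
    (∀ i : κ ⊕ Unit, Sum.elim α (fun _ => Fin m) i) ℂ}
  {ρ : Matrix (∀ i, α i) (∀ i, α i) ℂ} {σ : Matrix (Unit → Fin m) (Unit → Fin m) ℂ}

lemma matEntropy_reduce_of_product (hM : IsDensityMatrix M) (hρ : IsDensityMatrix ρ)
    (hσ : IsDensityMatrix σ)
    (h : ∀ z z', M z z' = (ρ ⊗ₖ σ) (leftPart z, rightPart z) (leftPart z', rightPart z'))
    (S : Finset κ) :
    matEntropy (reduce (S.image Sum.inl ∪ {Sum.inr ()}) M) =
      matEntropy (reduce S ρ) + matEntropy σ := by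
  rw [← matEntropy_kronecker (hρ.reduce S) hσ, reduce_eq_partialTrace S ρ,
    ← partialTrace_kronecker_left, ← partialTrace_comp_bijective split_bijective _ _ h]
  refine matEntropy_reduce_eq ?_ ?_ ?_ hM
  · rintro ⟨f, e⟩
    obtain ⟨w, rfl⟩ := restrict_surjective hρ.nonempty S f
    exact ⟨mergeSum w e, rfl⟩
  · intro z z'
    rw [forall_imp_eq_iff]
    simp [funext_iff]
  · intro z z'
    rw [forall_imp_eq_iff]
    simp [funext_iff]

/-- Extensions of a pure state are products. -/
lemma exists_eq_product_of_partialTrace_eq_vecState (hM : IsDensityMatrix M)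
    {φ : (∀ i, α i) → ℂ} (hφ : (vecState φ).trace = 1)
    (h : partialTrace leftPart rightPart M = vecState φ) :
    ∃ σ : Matrix (Unit → Fin m) (Unit → Fin m) ℂ, IsDensityMatrix σ ∧ ∀ z z', M z z' =
      (vecState φ ⊗ₖ σ) (leftPart z, rightPart z) (leftPart z', rightPart z') := by
  have hbij := split_bijective (α := α) (δ := fun _ : Unit => Fin m)
  let V : Matrix (∀ i : κ ⊕ Unit, Sum.elim α (fun _ => Fin m) i) (Unit → Fin m) ℂ :=
    Matrix.of fun z e => if rightPart z = e then φ (leftPart z) else 0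
  set A : Matrix (∀ i : κ ⊕ Unit, Sum.elim α (fun _ => Fin m) i)
    (∀ i : κ ⊕ Unit, Sum.elim α (fun _ => Fin m) i) ℂ :=
    ampliation leftPart rightPart (vecState φ) with hA
  have hVV : V * V.conjTranspose = A := by
    ext z z'
    simp only [V, hA, ampliation, vecState, Matrix.mul_apply, Matrix.conjTranspose_apply,
      Matrix.of_apply]
    rw [Finset.sum_eq_single (rightPart z)]
    · by_cases h : rightPart z = rightPart z'
      · simp [h]
      · simp [h, Ne.symm h]
    · intro b _ hb
      simp [Ne.symm hb]
    · simp
  have hAA : A * A = A := by rw [hA, ← ampliation_mul hbij, vecState_mul_self hφ]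
  have hAs : A.conjTranspose = A := by
    rw [← hVV, Matrix.conjTranspose_mul, Matrix.conjTranspose_conjTranspose]
  have htr : (M * A).trace = 1 := by
    rw [trace_mul_ampliation, h, vecState_mul_self hφ, hφ]
  obtain ⟨B, hB⟩ := hM.1.exists_eq_conjTranspose_mul_self
  have hBK : B * (1 - A) = 0 := by
    rw [← Matrix.trace_conjTranspose_mul_self_eq_zero_iff, Matrix.conjTranspose_mul,
      Matrix.conjTranspose_sub, Matrix.conjTranspose_one, hAs, Matrix.trace_mul_comm]
    have : B * (1 - A) * ((1 - A) * B.conjTranspose) = B * (1 - A) * B.conjTranspose := by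
      have : (1 - A) * (1 - A) = 1 - A := by
        rw [mul_sub, sub_mul, sub_mul, hAA]
        simp
      rw [mul_assoc, ← mul_assoc (1 - A), this, mul_assoc]
    rw [this, Matrix.trace_mul_comm, ← mul_assoc, ← hB, mul_sub, mul_one, Matrix.trace_sub, htr,
      hM.2, sub_self]
  have hMA : M * A = M := by
    have : M * (1 - A) = 0 := by rw [hB, mul_assoc, hBK, mul_zero]
    rw [mul_sub, mul_one, sub_eq_zero] at this
    exact this.symm
  have hAM : A * M = M := by
    have := congrArg Matrix.conjTranspose hMA
    rwa [Matrix.conjTranspose_mul, hAs, hM.1.1.eq] at this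
  refine ⟨V.conjTranspose * M * V, ⟨hM.1.conjTranspose_mul_mul_same V, ?_⟩, ?_⟩
  · rw [Matrix.mul_assoc, Matrix.trace_mul_comm, Matrix.mul_assoc, hVV, htr]
  · have hM' : M = V * (V.conjTranspose * M * V) * V.conjTranspose := by
      calc M = A * M * A := by rw [hAM, hMA]
        _ = _ := by simp only [← hVV, Matrix.mul_assoc]
    intro z z'
    conv_lhs => rw [hM']
    generalize V.conjTranspose * M * V = σ
    rw [Matrix.mul_apply, Finset.sum_eq_single (rightPart z')]
    · rw [Matrix.mul_apply, Finset.sum_eq_single (rightPart z)]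
      · simp [V, vecState]
        ring
      · intro b _ hb
        simp [V, Ne.symm hb]
      · simp
    · intro b _ hb
      simp [V, Ne.symm hb]
    · simp

end Extensions

section Squashed

open scoped Kronecker

variable {n : ℕ} {α : Fin n → Type} [∀ i, Fintype (α i)] [∀ i, DecidableEq (α i)]
  {ρ : Matrix (∀ i, α i) (∀ i, α i) ℂ}

lemma conditional_information_of_product {m : ℕ}
    {M : Matrix (∀ i : Fin n ⊕ Unit, Sum.elim α (fun _ => Fin m) i)
      (∀ i : Fin n ⊕ Unit, Sum.elim α (fun _ => Fin m) i) ℂ}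
    {σ : Matrix (Unit → Fin m) (Unit → Fin m) ℂ} (hM : IsDensityMatrix M)
    (hρ : IsDensityMatrix ρ) (hσ : IsDensityMatrix σ)
    (h : ∀ z z', M z z' = (ρ ⊗ₖ σ) (leftPart z, rightPart z) (leftPart z', rightPart z')) :
    ∑ k ∈ Finset.univ.filter (fun k : Fin n => (k : ℕ) ≠ 0),
      (matEntropy (reduce ((Finset.Iio k).image Sum.inl ∪ {Sum.inr ()}) M)
        + matEntropy (reduce (({k} : Finset (Fin n)).image Sum.inl ∪ {Sum.inr ()}) M)
        - matEntropy (reduce ((Finset.Iic k).image Sum.inl ∪ {Sum.inr ()}) M)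
        - matEntropy (reduce ({Sum.inr ()} : Finset (Fin n ⊕ Unit)) M)) = Imulti ρ := by
  have hS := matEntropy_reduce_of_product hM hρ hσ h
  have h0 : matEntropy (reduce ({Sum.inr ()} : Finset (Fin n ⊕ Unit)) M) = matEntropy σ := by
    have := hS ∅
    rwa [Finset.image_empty, Finset.empty_union, matEntropy_reduce_empty hρ, zero_add] at this
  rw [Imulti, ← matEntropy_reduce_univ hρ,
    ← sum_filter_ne_zero_Iio_add_sub_Iic (fun s => matEntropy (reduce s ρ))
      (matEntropy_reduce_empty hρ)]
  refine Finset.sum_congr rfl fun k _ => ?_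
  rw [hS, hS, hS, h0]
  ring

/-- The values over which `EsqMulti` takes the infimum. -/
def squashedValues (ρ : Matrix (∀ i, α i) (∀ i, α i) ℂ) : Set ℝ :=
  { x | ∃ (m : ℕ)
      (ρE : Matrix (∀ i : Fin n ⊕ Unit, Sum.elim α (fun _ => Fin m) i)
        (∀ i : Fin n ⊕ Unit, Sum.elim α (fun _ => Fin m) i) ℂ),
    ρE.PosSemidef ∧
    (∀ f g, (∑ h : ∀ _ : Unit, Fin m, ρE (mergeSum f h) (mergeSum g h)) = ρ f g) ∧
    x = ∑ k ∈ Finset.univ.filter (fun k : Fin n => (k : ℕ) ≠ 0),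
      (matEntropy (reduce ((Finset.Iio k).image Sum.inl ∪ {Sum.inr ()}) ρE)
        + matEntropy (reduce (({k} : Finset (Fin n)).image Sum.inl ∪ {Sum.inr ()}) ρE)
        - matEntropy (reduce ((Finset.Iic k).image Sum.inl ∪ {Sum.inr ()}) ρE)
        - matEntropy (reduce ({Sum.inr ()} : Finset (Fin n ⊕ Unit)) ρE)) }

lemma Imulti_mem_squashedValues (hρ : IsDensityMatrix ρ) : Imulti ρ ∈ squashedValues ρ := by
  let M : Matrix (∀ i : Fin n ⊕ Unit, Sum.elim α (fun _ => Fin 1) i)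
    (∀ i : Fin n ⊕ Unit, Sum.elim α (fun _ => Fin 1) i) ℂ := ρ.submatrix leftPart leftPart
  have hM : M.PosSemidef := hρ.1.submatrix leftPart
  have hext (f g) : ∑ h : ∀ _ : Unit, Fin 1, M (mergeSum f h) (mergeSum g h) = ρ f g := by
    rw [Fintype.sum_unique]
    rfl
  refine ⟨1, M, hM, hext, ?_⟩
  have hM' : IsDensityMatrix M := isDensityMatrix_of_partialTrace_leftPart hM
    (by ext f g; rw [partialTrace_leftPart_apply, hext]) hρ
  refine (conditional_information_of_product hM' hρ (σ := 1)
    ⟨Matrix.PosSemidef.one, by simp⟩ fun z z' => ?_).symm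
  rw [Matrix.kroneckerMap_apply, Subsingleton.elim (rightPart z) (rightPart z'),
    Matrix.one_apply_eq, mul_one]
  rfl

lemma EsqMulti_le_Imulti (hρ : IsDensityMatrix ρ) : EsqMulti ρ ≤ Imulti ρ := by
  change sInf (squashedValues ρ) ≤ _
  by_cases hb : BddBelow (squashedValues ρ)
  · exact csInf_le hb (Imulti_mem_squashedValues hρ)
  · rw [Real.sInf_of_not_bddBelow hb]
    exact Imulti_nonneg hρ

lemma EsqMulti_vecState {φ : (∀ i, α i) → ℂ} (hφ : IsDensityMatrix (vecState φ)) :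
    EsqMulti (vecState φ) = Imulti (vecState φ) := by
  change sInf (squashedValues (vecState φ)) = _
  have : squashedValues (vecState φ) = {Imulti (vecState φ)} := by
    refine Set.eq_singleton_iff_unique_mem.2 ⟨Imulti_mem_squashedValues hφ, ?_⟩
    rintro x ⟨m, M, hM, hext, rfl⟩
    have h : partialTrace leftPart rightPart M = vecState φ := by
      ext f g
      rw [partialTrace_leftPart_apply, hext]
    have hM' := isDensityMatrix_of_partialTrace_leftPart hM h hφ
    obtain ⟨σ, hσ, hp⟩ := exists_eq_product_of_partialTrace_eq_vecState hM' hφ.2 h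
    exact conditional_information_of_product hM' hφ hσ hp
  rw [this, csInf_singleton]

end Squashed

section Purification

variable {κ : Type} [Fintype κ] [DecidableEq κ] {α : κ → Type} [∀ i, Fintype (α i)]
  [∀ i, DecidableEq (α i)] {ρ : Matrix (∀ i, α i) (∀ i, α i) ℂ}

lemma exists_purifies (hρ : ρ.PosSemidef) :
    ∃ (d : κ → ℕ) (ψ : (∀ i : κ ⊕ κ, Sum.elim α (fun k => Fin (d k)) i) → ℂ), Purifies ψ ρ := by
  obtain ⟨B, hB⟩ := hρ.exists_eq_conjTranspose_mul_self
  let e : (∀ k, Fin (Fintype.card (α k))) ≃ ∀ k, α k :=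
    Equiv.piCongrRight fun k => (Fintype.equivFin (α k)).symm
  refine ⟨fun k => Fintype.card (α k), fun z => star (B (e (rightPart z)) (leftPart z)),
    fun f g => ?_⟩
  rw [hB, Matrix.mul_apply, ← e.sum_comp]
  refine Finset.sum_congr rfl fun h _ => ?_
  simp only [vecState, Matrix.of_apply, star_star, Matrix.conjTranspose_apply]
  rfl

lemma Purifies.partialTrace_eq {d : κ → ℕ}
    {ψ : (∀ i : κ ⊕ κ, Sum.elim α (fun k => Fin (d k)) i) → ℂ} (h : Purifies ψ ρ) :
    partialTrace leftPart rightPart (vecState ψ) = ρ := by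
  ext f g
  rw [partialTrace_leftPart_apply]
  exact h f g

lemma Imulti_le_of_purifies (hρ : IsDensityMatrix ρ) {d : κ → ℕ}
    {ψ : (∀ i : κ ⊕ κ, Sum.elim α (fun k => Fin (d k)) i) → ℂ} (h : Purifies ψ ρ) :
    Imulti ρ ≤ ∑ k, matEntropy (reduce (partyFinset id k) (vecState ψ)) := by
  have hψ := isDensityMatrix_of_partialTrace_leftPart (vecState_posSemidef ψ) h.partialTrace_eq hρ
  have hinl := matEntropy_reduce_image_inl hψ h.partialTrace_eq
  have hparty (k : κ) : partyFinset (id : κ → κ) k = {Sum.inl k} ∪ {Sum.inr k} := by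
    ext i
    cases i <;> simp [partyFinset, eq_comm]
  have key (T : Finset κ) :
      matEntropy (reduce (Finset.univ.image Sum.inl ∪ T.image Sum.inr) (vecState ψ)) -
        matEntropy ρ ≤ ∑ k ∈ T, (matEntropy (reduce (partyFinset id k) (vecState ψ)) -
          matEntropy (reduce {k} ρ)) := by
    induction T using Finset.induction_on with
    | empty =>
      rw [Finset.image_empty, Finset.union_empty, hinl, matEntropy_reduce_univ hρ]
      simp
    | insert k T hk ih =>
      have hs := matEntropy_reduce_strong_subadditivity hψ
        (s := (Finset.univ.erase k).image Sum.inl ∪ T.image Sum.inr) (t := {Sum.inl k})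
        (u := {Sum.inr k}) (by simp) (by simpa using hk) (by simp)
      have h1 : (Finset.univ.erase k).image Sum.inl ∪ T.image Sum.inr ∪ {Sum.inl k} =
          Finset.univ.image Sum.inl ∪ T.image Sum.inr := by
        ext i
        cases i <;> simp [em]
      have h2 : Finset.univ.image (Sum.inl : κ → κ ⊕ κ) ∪ T.image Sum.inr ∪ {Sum.inr k} =
          Finset.univ.image Sum.inl ∪ (insert k T).image Sum.inr := by
        ext i
        cases i <;> simp [or_comm]
      have h3 := hinl {k}
      rw [Finset.image_singleton] at h3
      rw [h1, h2, h3, ← hparty] at hs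
      rw [Finset.sum_insert hk]
      linarith
  have hu : (Finset.univ : Finset κ).image (Sum.inl : κ → κ ⊕ κ) ∪ Finset.univ.image Sum.inr =
      Finset.univ := by
    ext i
    cases i <;> simp
  have := key Finset.univ
  rw [hu, matEntropy_reduce_univ hψ, matEntropy_vecState hψ.2, Finset.sum_sub_distrib] at this
  rw [Imulti]
  linarith

lemma Imulti_le_DeltaPart (hρ : IsDensityMatrix ρ) : Imulti ρ ≤ DeltaPart id ρ := by
  refine le_csInf ?_ ?_
  · obtain ⟨d, ψ, h⟩ := exists_purifies hρ.1
    exact ⟨_, d, ψ, h, rfl⟩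
  · rintro x ⟨d, ψ, h, rfl⟩
    exact Imulti_le_of_purifies hρ h

lemma Imulti_vecState_eq_DeltaPart {φ : (∀ i, α i) → ℂ} (hφ : IsDensityMatrix (vecState φ)) :
    Imulti (vecState φ) = DeltaPart id (vecState φ) := by
  refine le_antisymm (Imulti_le_DeltaPart hφ) (csInf_le ?_ ?_)
  · refine ⟨Imulti (vecState φ), ?_⟩
    rintro x ⟨d, ψ, h, rfl⟩
    exact Imulti_le_of_purifies hφ h
  · have h : Purifies (fun z : (∀ i : κ ⊕ κ, Sum.elim α (fun _ => Fin 1) i) => φ (leftPart z))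
        (vecState φ) := by
      intro f g
      rw [Fintype.sum_unique]
      rfl
    have hψ := isDensityMatrix_of_partialTrace_leftPart (vecState_posSemidef _)
      h.partialTrace_eq hφ
    refine ⟨fun _ => 1, _, h, ?_⟩
    rw [Imulti, matEntropy_vecState hφ.2, sub_zero]
    refine Finset.sum_congr rfl fun k _ => ?_
    refine (matEntropy_reduce_of_subsingleton (fun a => ?_) hψ fun z z' => rfl).symm
    simp [partyFinset, eq_comm]

end Purification

/-- chain of inequalities `E_sq^q ≤ I ≤ Δ_P` for any `n`-partite
state, with equality throughout for pure states. -/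
theorem Esq_le_MI_le_DeltaP {n : ℕ} {α : Fin n → Type}
    [∀ i, Fintype (α i)] [∀ i, DecidableEq (α i)]
    (ρ : Matrix (∀ i, α i) (∀ i, α i) ℂ) (hρ : IsDensityMatrix ρ) :
    (EsqMulti ρ ≤ Imulti ρ ∧ Imulti ρ ≤ DeltaPart id ρ) ∧
    (∀ φ : (∀ i, α i) → ℂ, ρ = vecState φ →
      EsqMulti ρ = Imulti ρ ∧ Imulti ρ = DeltaPart id ρ) := by
  refine ⟨⟨EsqMulti_le_Imulti hρ, Imulti_le_DeltaPart hρ⟩, ?_⟩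
  rintro φ rfl
  exact ⟨EsqMulti_vecState hρ, Imulti_vecState_eq_DeltaPart hρ⟩
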